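/- Suppose A is Γ-graded D-simple and 𝒥 is finite, and let γ ∈ 𝒥 be its maximal element (γ_i = p−1 if char F = p > 0 and deg(d_i) ∉ Γ₋, and γ_i = 1 if deg(d_i) ∈ Γ₋). Then W = (⊕_{α∈𝒥, α≠γ} A d^α) ⊕ 𝒟(A) d^γ, where 𝒟(A) is the F-span of {∂(a) : ∂ ∈ 𝒟, a ∈ A} and W = [A[D],A[D]]. -/

import Mathlib

/-- A skew-symmetric bicharacter `ε : Γ × Γ → F^×`. -/
def IsBichar {F : Type} [Field F] {Γ : Type} [AddCommGroup Γ] (ε : Γ → Γ → F) : Prop :=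
  (∀ lam mu, ε lam mu * ε mu lam = 1) ∧
  (∀ lam mu nu, ε lam (mu + nu) = ε lam mu * ε lam nu)

variable (F : Type) [Field F] (Γ : Type) [AddCommGroup Γ] [DecidableEq Γ]
  (A : Type) [Ring A] [Algebra F A]

/-- left multiplication operators -/
noncomputable def mulL : A →ₗ[F] Module.End F A := (Algebra.lmul F A).toLinearMap

variable {F Γ A}

/-- `f ∈ End_F(A)` is homogeneous of degree `δ`. -/
def IsHomogMap (𝒜 : Γ → Submodule F A) (δ : Γ) (f : Module.End F A) : Prop :=
  ∀ lam : Γ, ∀ a ∈ 𝒜 lam, f a ∈ 𝒜 (lam + δ)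

/-- `f` is a homogeneous color-derivation of degree `δ`. -/
def IsColorDer (𝒜 : Γ → Submodule F A) (ε : Γ → Γ → F) (δ : Γ) (f : Module.End F A) : Prop :=
  IsHomogMap 𝒜 δ f ∧
  ∀ lam : Γ, ∀ a ∈ 𝒜 lam, ∀ b : A, f (a * b) = f a * b + ε δ lam • (a * f b)

/-- `Der^ε(A)`: the F-span of homogeneous color derivations. -/
def DerE (𝒜 : Γ → Submodule F A) (ε : Γ → Γ → F) : Submodule F (Module.End F A) :=
  Submodule.span F {f | ∃ δ, IsColorDer 𝒜 ε δ f}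

/-- `A` is ε-commutative. -/
def IsColorComm (𝒜 : Γ → Submodule F A) (ε : Γ → Γ → F) : Prop :=
  ∀ lam mu : Γ, ∀ a ∈ 𝒜 lam, ∀ b ∈ 𝒜 mu, a * b = ε lam mu • (b * a)

/-- `D` is color-commutative. -/
def DColorComm (𝒜 : Γ → Submodule F A) (ε : Γ → Γ → F) (D : Submodule F (Module.End F A)) : Prop :=
  ∀ δ δ' f g, f ∈ D → g ∈ D → IsColorDer 𝒜 ε δ f → IsColorDer 𝒜 ε δ' g →
    f * g = ε δ δ' • (g * f)

/-- `D` is a Γ-graded subspace: it is spanned by its homogeneous color-derivations. -/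
def DGraded (𝒜 : Γ → Submodule F A) (ε : Γ → Γ → F) (D : Submodule F (Module.End F A)) : Prop :=
  D = Submodule.span F {f | f ∈ D ∧ ∃ δ, IsColorDer 𝒜 ε δ f}

/-- `A[D]`: the unital subalgebra of `End_F(A)` generated by left multiplications and `D`. -/
noncomputable def AD (D : Submodule F (Module.End F A)) : Subalgebra F (Module.End F A) :=
  Algebra.adjoin F (Set.range (mulL F A) ∪ (D : Set (Module.End F A)))

/-- `A` is Γ-graded `D`-simple. -/
def GradedDSimple (𝒜 : Γ → Submodule F A) [GradedAlgebra 𝒜] (D : Submodule F (Module.End F A)) :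
    Prop :=
  ∀ I : Ideal A, Ideal.IsHomogeneous 𝒜 I → (∀ f ∈ D, ∀ x ∈ I, f x ∈ I) → I = ⊥ ∨ I = ⊤

/-- F₁ = A^D -/
def F1 (D : Submodule F (Module.End F A)) : Submodule F A where
  carrier := {u | ∀ f ∈ D, f u = 0}
  add_mem' := by
    intro a b ha hb f hf
    rw [map_add, ha f hf, hb f hf, add_zero]
  zero_mem' := by intro f hf; exact map_zero f
  smul_mem' := by
    intro c x hx f hf
    rw [map_smul, hx f hf, smul_zero]

/-- the derived space `W = [A[D], A[D]]`. -/
def Wsub (𝒜 : Γ → Submodule F A) (ε : Γ → Γ → F) (D : Submodule F (Module.End F A)) :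
    Submodule F (Module.End F A) :=
  Submodule.span F {w | ∃ γ γ' x y, x ∈ AD D ∧ y ∈ AD D ∧
    IsHomogMap 𝒜 γ x ∧ IsHomogMap 𝒜 γ' y ∧ w = x * y - ε γ γ' • (y * x)}

/-- `F₁[D]`. -/
noncomputable def F1D (D : Submodule F (Module.End F A)) : Subalgebra F (Module.End F A) :=
  Algebra.adjoin F ((mulL F A '' (F1 D : Set A)) ∪ (D : Set (Module.End F A)))

/-- `𝒟 = Der^ε(A) ∩ F₁[D]`. -/
def DScr (𝒜 : Γ → Submodule F A) (ε : Γ → Γ → F) (D : Submodule F (Module.End F A)) :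
    Set (Module.End F A) :=
  {f | f ∈ F1D D ∧ f ∈ DerE 𝒜 ε}

variable {I : Type} [LinearOrder I]

/-- ordered product `d^α`. -/
noncomputable def dpow (d : I → Module.End F A) (α : I →₀ ℕ) : Module.End F A :=
  ((α.support.sort (· ≤ ·)).map fun i => d i ^ α i).prod

/-- membership in the index set 𝒥. -/
def inJ (ε : Γ → Γ → F) (δd : I → Γ) (α : I →₀ ℕ) : Prop :=
  (∀ i, ringChar F ≠ 0 → α i ≤ ringChar F - 1) ∧
  (∀ i, ε (δd i) (δd i) = -1 → α i ≤ 1)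

/-- the degree of `d^α`. -/
def degJ (δd : I → Γ) (α : I →₀ ℕ) : Γ := α.sum fun i n => n • δd i

/-- the subalgebra `S` of `End_F(A)` is Γ-graded simple. -/
def GradedSimpleAlgOn (𝒜 : Γ → Submodule F A) (S : Subalgebra F (Module.End F A)) : Prop :=
  ∀ L : Submodule F (Module.End F A),
    L ≤ Subalgebra.toSubmodule S →
    (∀ x ∈ S, ∀ y ∈ L, x * y ∈ L ∧ y * x ∈ L) →
    L = Submodule.span F {f | f ∈ L ∧ ∃ δ, IsHomogMap 𝒜 δ f} →
    (L = ⊥ ∨ L = Subalgebra.toSubmodule S)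

/-- variant of 𝒥 without characteristic restriction -/
def inJ0 (ε : Γ → Γ → F) (δd : I → Γ) (α : I →₀ ℕ) : Prop :=
  ∀ i, ε (δd i) (δd i) = -1 → α i ≤ 1

/-- the sum `Σ_{α ∈ J0} B d^α` is direct -/
def DirectOn (d : I → Module.End F A) (J0 : Set (I →₀ ℕ)) (Bs : Set A) : Prop :=
  ∀ (s : Finset (I →₀ ℕ)) (c : (I →₀ ℕ) → A), ↑s ⊆ J0 → (∀ α ∈ s, c α ∈ Bs) →
    (∑ α ∈ s, mulL F A (c α) * dpow d α) = 0 → ∀ α ∈ s, mulL F A (c α) * dpow d α = 0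

/-- span of color brackets of homogeneous elements of `M` and `N` -/
def brkE (𝒜 : Γ → Submodule F A) (ε : Γ → Γ → F) (M N : Submodule F (Module.End F A)) :
    Submodule F (Module.End F A) :=
  Submodule.span F {w | ∃ γ γ' x y, x ∈ M ∧ y ∈ N ∧
    IsHomogMap 𝒜 γ x ∧ IsHomogMap 𝒜 γ' y ∧ w = x * y - ε γ γ' • (y * x)}

set_option linter.unusedSectionVars false

section Bicharacter

variable {ε : Γ → Γ → F}

theorem IsBichar.ne_zero (h : IsBichar ε) (a b : Γ) : ε a b ≠ 0 :=
  left_ne_zero_of_mul_eq_one (h.1 a b)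

theorem IsBichar.add_right (h : IsBichar ε) (a b c : Γ) : ε a (b + c) = ε a b * ε a c :=
  h.2 a b c

theorem IsBichar.swap (h : IsBichar ε) (a b : Γ) : ε a b = (ε b a)⁻¹ :=
  eq_inv_of_mul_eq_one_left (h.1 a b)

theorem IsBichar.add_left (h : IsBichar ε) (a b c : Γ) : ε (a + b) c = ε a c * ε b c := by
  rw [h.swap, h.add_right, h.swap a c, h.swap b c, mul_inv]

theorem IsBichar.zero_right (h : IsBichar ε) (a : Γ) : ε a 0 = 1 := by
  have := h.add_right a 0 0
  rw [add_zero] at this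
  exact (mul_eq_left₀ (h.ne_zero a 0)).1 this.symm

theorem IsBichar.zero_left (h : IsBichar ε) (a : Γ) : ε 0 a = 1 := by
  rw [h.swap, h.zero_right, inv_one]

theorem IsBichar.neg_right (h : IsBichar ε) (a b : Γ) : ε a (-b) = ε b a := by
  rw [h.swap b a]
  apply eq_inv_of_mul_eq_one_left
  rw [← h.add_right, neg_add_cancel, h.zero_right]

theorem IsBichar.self_eq (h : IsBichar ε) (a : Γ) : ε a a = 1 ∨ ε a a = -1 :=
  mul_self_eq_one_iff.1 (h.1 a a)

theorem IsBichar.nsmul_left (h : IsBichar ε) (n : ℕ) (a b : Γ) : ε (n • a) b = ε a b ^ n := by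
  induction n with
  | zero => simp [h.zero_left]
  | succ n ih => rw [succ_nsmul, h.add_left, ih, pow_succ]

end Bicharacter

theorem mulL_apply (a b : A) : mulL F A a b = a * b := rfl

theorem mulL_mul (a b : A) : mulL F A (a * b) = mulL F A a * mulL F A b :=
  map_mul (Algebra.lmul F A) a b

theorem mulL_one : mulL F A 1 = 1 := map_one (Algebra.lmul F A)

/-- Homogeneous endomorphisms of a fixed degree. -/
def homogEnd (𝒜 : Γ → Submodule F A) (δ : Γ) : Submodule F (Module.End F A) where
  carrier := {f | IsHomogMap 𝒜 δ f}
  add_mem' hf hg lam a ha := add_mem (hf lam a ha) (hg lam a ha)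
  zero_mem' lam _ _ := zero_mem (𝒜 (lam + δ))
  smul_mem' c _ hf lam a ha := Submodule.smul_mem _ c (hf lam a ha)

section Homogeneous

variable {𝒜 : Γ → Submodule F A} {ε : Γ → Γ → F}

theorem IsHomogMap.mul {δ δ' : Γ} {f g : Module.End F A} (hf : IsHomogMap 𝒜 δ f)
    (hg : IsHomogMap 𝒜 δ' g) : IsHomogMap 𝒜 (δ + δ') (f * g) := by
  intro lam a ha
  have := hf _ _ (hg lam a ha)
  rwa [add_assoc, add_comm δ'] at this

theorem isHomogMap_one : IsHomogMap 𝒜 0 (1 : Module.End F A) := by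
  intro lam a ha
  rwa [add_zero]

variable [GradedAlgebra 𝒜]

theorem isHomogMap_mulL {lam : Γ} {a : A} (ha : a ∈ 𝒜 lam) : IsHomogMap 𝒜 lam (mulL F A a) := by
  intro mu b hb
  rw [add_comm, mulL_apply]
  exact SetLike.mul_mem_graded ha hb

theorem mem_of_homogeneous {M : Type*} [AddCommMonoid M] [Module F M] {f : A →ₗ[F] M}
    {P : Submodule F M} (h : ∀ lam, ∀ a ∈ 𝒜 lam, f a ∈ P) (a : A) : f a ∈ P := by
  induction a using DirectSum.Decomposition.inductionOn 𝒜 with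
  | zero => rw [map_zero]; exact zero_mem P
  | homogeneous m => exact h _ m m.2
  | add x y hx hy => rw [map_add]; exact add_mem hx hy

theorem ext_homogeneous {M : Type*} [AddCommMonoid M] [Module F M] {f g : A →ₗ[F] M}
    (h : ∀ lam, ∀ a ∈ 𝒜 lam, f a = g a) : f = g := by
  ext a
  induction a using DirectSum.Decomposition.inductionOn 𝒜 with
  | zero => simp
  | homogeneous m => exact h _ m m.2
  | add x y hx hy => rw [map_add, map_add, hx, hy]

theorem proj_homogeneous {δ : Γ} {f : Module.End F A} (hf : IsHomogMap 𝒜 δ f) (x : A) (mu : Γ) :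
    (DirectSum.decompose 𝒜 (f x) mu : A) = f (DirectSum.decompose 𝒜 x (mu - δ)) := by
  induction x using DirectSum.Decomposition.inductionOn 𝒜 with
  | zero => simp
  | @homogeneous lam m =>
    by_cases hlam : lam + δ = mu
    · subst hlam
      rw [add_sub_cancel_right, DirectSum.decompose_of_mem_same 𝒜 (hf _ m m.2),
        DirectSum.decompose_of_mem_same 𝒜 m.2]
    · rw [DirectSum.decompose_of_mem_ne 𝒜 (hf _ m m.2) hlam,
        DirectSum.decompose_of_mem_ne 𝒜 m.2 (fun h => hlam (by rw [h, sub_add_cancel])), map_zero]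
  | add x y hx hy => simp [DirectSum.decompose_add, hx, hy]

theorem mem_of_mem_iSup_homogeneous {P : Γ → Submodule F (Module.End F A)}
    (hP : ∀ δ, P δ ≤ homogEnd 𝒜 δ) {x : Module.End F A} (hx : x ∈ ⨆ δ, P δ) {δ : Γ}
    (hxδ : IsHomogMap 𝒜 δ x) : x ∈ P δ := by
  obtain ⟨f, hf, rfl⟩ := (Submodule.mem_iSup_iff_exists_finsupp _ _).1 hx
  suffices h : (f.sum fun _ x => x) = f δ by
    rw [h]; exact hf δ
  refine ext_homogeneous (𝒜 := 𝒜) fun lam a ha => ?_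
  rw [← DirectSum.decompose_of_mem_same 𝒜 (hxδ lam a ha), Finsupp.sum, LinearMap.sum_apply,
    DirectSum.decompose_sum, DFinsupp.finsetSum_apply, AddSubmonoidClass.coe_finsetSum,
    Finset.sum_eq_single δ]
  · exact DirectSum.decompose_of_mem_same 𝒜 (hP δ (hf δ) lam a ha)
  · intro δ' _ hne
    exact DirectSum.decompose_of_mem_ne 𝒜 (hP δ' (hf δ') lam a ha) fun h => hne (add_left_cancel h)
  · intro hδ
    simp [Finsupp.notMem_support_iff.1 hδ]

theorem adjoin_le_iSup {P : Γ → Submodule F (Module.End F A)} {s : Set (Module.End F A)}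
    (hone : 1 ∈ P 0) (hmul : ∀ δ δ' f g, f ∈ P δ → g ∈ P δ' → f * g ∈ P (δ + δ'))
    (hs : ∀ x ∈ s, x ∈ ⨆ δ, P δ) {x : Module.End F A} (hx : x ∈ Algebra.adjoin F s) :
    x ∈ ⨆ δ, P δ := by
  induction hx using Algebra.adjoin_induction with
  | mem x hx => exact hs x hx
  | algebraMap r =>
    rw [Algebra.algebraMap_eq_smul_one]
    exact Submodule.smul_mem _ _ (Submodule.mem_iSup_of_mem 0 hone)
  | add x y _ _ hx hy => exact add_mem hx hy
  | mul x y hx' hy' hx hy =>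
    clear hx' hy'
    induction hx using Submodule.iSup_induction' with
    | mem δ f hf =>
      induction hy using Submodule.iSup_induction' with
      | mem δ' g hg => exact Submodule.mem_iSup_of_mem _ (hmul _ _ _ _ hf hg)
      | zero => rw [mul_zero]; exact zero_mem _
      | add x y _ _ hx hy => rw [mul_add]; exact add_mem hx hy
    | zero => rw [zero_mul]; exact zero_mem _
    | add x y _ _ hx hy => rw [add_mul]; exact add_mem hx hy

/-- Homogeneous endomorphisms of degree `δ` that color-commute with a given family. -/
def colorCentralizer (𝒜 : Γ → Submodule F A) (ε : Γ → Γ → F) (S : Γ → Module.End F A → Prop)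
    (δ : Γ) : Submodule F (Module.End F A) where
  carrier := {f | IsHomogMap 𝒜 δ f ∧ ∀ δ' g, S δ' g → f * g = ε δ δ' • (g * f)}
  add_mem' {f f'} hf hf' := ⟨(homogEnd 𝒜 δ).add_mem hf.1 hf'.1, fun δ' g hg => by
    rw [add_mul, hf.2 δ' g hg, hf'.2 δ' g hg, mul_add, smul_add]⟩
  zero_mem' := ⟨(homogEnd 𝒜 δ).zero_mem, fun δ' g _ => by simp⟩
  smul_mem' c f hf := ⟨(homogEnd 𝒜 δ).smul_mem c hf.1, fun δ' g hg => by
    rw [smul_mul_assoc, hf.2 δ' g hg, mul_smul_comm, smul_comm]⟩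

theorem mem_colorCentralizer_of_mem_adjoin (hε : IsBichar ε) {S : Γ → Module.End F A → Prop}
    {s : Set (Module.End F A)} (hs : ∀ x ∈ s, x ∈ ⨆ δ, colorCentralizer 𝒜 ε S δ)
    {δ : Γ} {x : Module.End F A} (hx : x ∈ Algebra.adjoin F s) (hxδ : IsHomogMap 𝒜 δ x) :
    x ∈ colorCentralizer 𝒜 ε S δ := by
  refine mem_of_mem_iSup_homogeneous (fun δ f (hf : f ∈ colorCentralizer 𝒜 ε S δ) => hf.1)
    (adjoin_le_iSup ?_ ?_ hs hx) hxδ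
  · exact ⟨isHomogMap_one, fun δ' g _ => by simp [hε.zero_left]⟩
  · rintro δ₁ δ₂ f g ⟨hf, hfc⟩ ⟨hg, hgc⟩
    refine ⟨hf.mul hg, fun δ' k hk => ?_⟩
    rw [mul_assoc, hgc δ' k hk, mul_smul_comm, ← mul_assoc, hfc δ' k hk, smul_mul_assoc, smul_smul,
      hε.add_left, mul_assoc, mul_comm]

end Homogeneous

section ColorDerivations

variable {𝒜 : Γ → Submodule F A} [GradedAlgebra 𝒜] {ε : Γ → Γ → F} {D : Submodule F (Module.End F A)}

theorem IsColorDer.map_one {δ : Γ} {f : Module.End F A} (hε : IsBichar ε)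
    (hf : IsColorDer 𝒜 ε δ f) : f 1 = 0 := by
  have := hf.2 0 1 (SetLike.one_mem_graded 𝒜) 1
  simpa [hε.zero_right] using this

theorem IsColorDer.mul_mulL {δ lam : Γ} {f : Module.End F A} (hf : IsColorDer 𝒜 ε δ f) {a : A}
    (ha : a ∈ 𝒜 lam) :
    f * mulL F A a = mulL F A (f a) + ε δ lam • (mulL F A a * f) := by
  ext b
  exact hf.2 lam a ha b

theorem IsHomogMap.pow {δ : Γ} {f : Module.End F A} (hf : IsHomogMap 𝒜 δ f) (n : ℕ) :
    IsHomogMap 𝒜 (n • δ) (f ^ n) := by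
  induction n with
  | zero => simpa using isHomogMap_one
  | succ n ih => rw [pow_succ, succ_nsmul]; exact ih.mul hf

theorem IsColorDer.pow_char {δ : Γ} {f : Module.End F A} (hε : IsBichar ε)
    (hf : IsColorDer 𝒜 ε δ f) (hδ : ε δ δ = 1) (p : ℕ) [Fact p.Prime] [CharP F p] :
    IsColorDer 𝒜 ε (p • δ) (f ^ p) := by
  refine ⟨hf.1.pow p, fun lam a ha b => ?_⟩
  have : Nontrivial A ∨ Subsingleton A := (subsingleton_or_nontrivial A).symm
  obtain h | h := this
  swap
  · exact Subsingleton.elim _ _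
  have : CharP (Module.End F (Module.End F A)) p :=
    charP_of_injective_algebraMap (algebraMap F _).injective p
  let l : Module.End F (Module.End F A) := LinearMap.mulLeft F f
  let r : Module.End F (Module.End F A) := ε δ lam • LinearMap.mulRight F f
  have hcomm : Commute l r :=
    (LinearMap.commute_mulLeft_right f f).smul_right _
  have key : ∀ n : ℕ, ((l - r) ^ n) (mulL F A a) = mulL F A ((f ^ n) a) := by
    intro n
    induction n with
    | zero => simp
    | succ n ih =>
      rw [pow_succ', Module.End.mul_apply, ih, pow_succ', Module.End.mul_apply]
      have := hf.mul_mulL (hf.1.pow n lam a ha)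
      rw [hε.add_right, ← one_mul (f ^ n)] at this
      have hn : ε δ (n • δ) = 1 := by rw [hε.swap, hε.nsmul_left, hδ, one_pow, inv_one]
      rw [hn, mul_one, one_mul] at this
      simp [l, r, this]
  have hp := key p
  have hsub : (l - r) ^ p = l ^ p - r ^ p :=
    sub_pow_char_of_commute (R := Module.End F (Module.End F A)) p hcomm
  rw [hsub] at hp
  have h2 := congrArg (fun g : Module.End F A => g b) hp
  simp only [l, r, smul_pow, LinearMap.pow_mulLeft, LinearMap.pow_mulRight, LinearMap.sub_apply,
    LinearMap.smul_apply, LinearMap.mulLeft_apply, LinearMap.mulRight_apply,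
    Module.End.mul_apply, mulL_apply] at h2
  rw [hε.nsmul_left, ← h2]
  abel

theorem map_eq_zero_of_homogeneous (hD : DGraded 𝒜 ε D) {u : A}
    (h : ∀ δ f, f ∈ D → IsColorDer 𝒜 ε δ f → f u = 0) : u ∈ F1 D := by
  intro f hf
  rw [hD] at hf
  induction hf using Submodule.span_induction with
  | mem f hf => obtain ⟨hf, δ, hδ⟩ := hf; exact h δ f hf hδ
  | zero => rfl
  | add f g _ _ hf hg => rw [LinearMap.add_apply, hf, hg, add_zero]
  | smul c f _ hf => rw [LinearMap.smul_apply, hf, smul_zero]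

theorem proj_mem_F1 (hD : DGraded 𝒜 ε D) {u : A} (hu : u ∈ F1 D) (lam : Γ) :
    (DirectSum.decompose 𝒜 u lam : A) ∈ F1 D := by
  refine map_eq_zero_of_homogeneous hD fun δ f hf hδ => ?_
  have := proj_homogeneous hδ.1 u (lam + δ)
  rw [add_sub_cancel_right, hu f hf] at this
  simpa using this.symm

theorem mulL_mem_of_proj {P : Submodule F (Module.End F A)} {u : A}
    (h : ∀ lam, mulL F A (DirectSum.decompose 𝒜 u lam) ∈ P) : mulL F A u ∈ P := by
  classical
  rw [← DirectSum.sum_support_decompose 𝒜 u, map_sum]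
  exact sum_mem fun lam _ => h lam

theorem F1D_colorComm (hε : IsBichar ε) (hA : IsColorComm 𝒜 ε) (hD : DGraded 𝒜 ε D)
    (hDc : DColorComm 𝒜 ε D) {δ δ' : Γ} {f g : Module.End F A} (hf : f ∈ F1D D) (hg : g ∈ F1D D)
    (hfδ : IsHomogMap 𝒜 δ f) (hgδ : IsHomogMap 𝒜 δ' g) : f * g = ε δ δ' • (g * f) := by
  let gen : Γ → Module.End F A → Prop := fun δ f =>
    (∃ u ∈ F1 D, u ∈ 𝒜 δ ∧ f = mulL F A u) ∨ (f ∈ D ∧ IsColorDer 𝒜 ε δ f)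
  have hgenHom : ∀ δ f, gen δ f → IsHomogMap 𝒜 δ f := by
    rintro δ f (⟨u, -, hu, rfl⟩ | hf)
    · exact isHomogMap_mulL hu
    · exact hf.2.1
  have hmixed : ∀ δ δ' f u, f ∈ D → IsColorDer 𝒜 ε δ f → u ∈ F1 D → u ∈ 𝒜 δ' →
      f * mulL F A u = ε δ δ' • (mulL F A u * f) := by
    intro δ δ' f u hf hfd hu hud
    rw [hfd.mul_mulL hud, hu f hf, map_zero, zero_add]
  have hgenComm : ∀ δ δ' f g, gen δ f → gen δ' g → f * g = ε δ δ' • (g * f) := by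
    rintro δ δ' f g (⟨u, hu, hud, rfl⟩ | ⟨hf, hfd⟩) (⟨v, hv, hvd, rfl⟩ | ⟨hg, hgd⟩)
    · rw [← mulL_mul, hA _ _ _ hud _ hvd, map_smul, mulL_mul]
    · rw [hmixed _ _ _ _ hg hgd hu hud, smul_smul, hε.1, one_smul]
    · exact hmixed _ _ _ _ hf hfd hv hvd
    · exact hDc _ _ _ _ hf hg hfd hgd
  have hcover : ∀ S : Γ → Module.End F A → Prop,
      (∀ δ f, gen δ f → f ∈ colorCentralizer 𝒜 ε S δ) →
      ∀ x ∈ (mulL F A '' (F1 D : Set A)) ∪ (D : Set (Module.End F A)),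
        x ∈ ⨆ δ, colorCentralizer 𝒜 ε S δ := by
    rintro S hS x (⟨u, hu, rfl⟩ | hx)
    · refine mulL_mem_of_proj (𝒜 := 𝒜) fun lam => Submodule.mem_iSup_of_mem lam (hS _ _ (.inl
        ⟨_, proj_mem_F1 hD hu lam, SetLike.coe_mem _, rfl⟩))
    · rw [SetLike.mem_coe, hD] at hx
      refine Submodule.span_le.2 ?_ hx
      rintro f ⟨hf, δ, hδ⟩
      exact Submodule.mem_iSup_of_mem δ (hS _ _ (.inr ⟨hf, hδ⟩))
  refine (mem_colorCentralizer_of_mem_adjoin (S := fun δ f => f ∈ F1D D ∧ IsHomogMap 𝒜 δ f) hε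
    (hcover _ fun δ f hf => ⟨hgenHom δ f hf, ?_⟩) hf hfδ).2 δ' g ⟨hg, hgδ⟩
  rintro δ' g ⟨hg, hgδ⟩
  rw [(mem_colorCentralizer_of_mem_adjoin (S := gen) hε (hcover _ fun δ f hf =>
    ⟨hgenHom δ f hf, fun δ' g hg => hgenComm _ _ _ _ hf hg⟩) hg hgδ).2 δ f hf, smul_smul, hε.1,
    one_smul]

end ColorDerivations

/-- The data of a graded `D`-simple color-commutative algebra with a homogeneous `F₁`-basis `d` of
`𝒟`. -/
structure IsColorDiffSimple (𝒜 : Γ → Submodule F A) [GradedAlgebra 𝒜] (ε : Γ → Γ → F)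
    (D : Submodule F (Module.End F A)) (d : I → Module.End F A) (δd : I → Γ) : Prop where
  two_ne_zero : (2 : F) ≠ 0
  bichar : IsBichar ε
  comm : IsColorComm 𝒜 ε
  le_der : D ≤ DerE 𝒜 ε
  graded : DGraded 𝒜 ε D
  colorComm : DColorComm 𝒜 ε D
  ne_bot : D ≠ ⊥
  simple : GradedDSimple 𝒜 D
  mem : ∀ i, d i ∈ DScr 𝒜 ε D
  der : ∀ i, IsColorDer 𝒜 ε (δd i) (d i)
  exists_sum : ∀ f ∈ DScr 𝒜 ε D, ∃ (s : Finset I) (c : I → A),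
    (∀ i, c i ∈ F1 D) ∧ f = ∑ i ∈ s, mulL F A (c i) * d i
  indep : ∀ (s : Finset I) (c : I → A), (∀ i, c i ∈ F1 D) →
    (∑ i ∈ s, mulL F A (c i) * d i) = 0 → ∀ i ∈ s, c i = 0

/-- The degree `lam` part of the right `A`-module generated by the vectors `(d j a)_j`, where the
`j`-th coordinate is shifted by the degree of `d j`. -/
def gradientSpan (𝒜 : Γ → Submodule F A) (d : I → Module.End F A) (lam : Γ) :
    Submodule F (I → A) :=
  Submodule.span F {v | ∃ mu nu a b, mu + nu = lam ∧ a ∈ 𝒜 mu ∧ b ∈ 𝒜 nu ∧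
    v = fun j => d j a * b}

namespace IsColorDiffSimple

variable {𝒜 : Γ → Submodule F A} [GradedAlgebra 𝒜] {ε : Γ → Γ → F}
  {D : Submodule F (Module.End F A)} {d : I → Module.End F A} {δd : I → Γ}

theorem nontrivial (h : IsColorDiffSimple 𝒜 ε D d δd) : Nontrivial A := by
  by_contra hA
  rw [not_nontrivial_iff_subsingleton] at hA
  exact h.ne_bot ((Submodule.eq_bot_iff _).2 fun f _ => LinearMap.ext fun _ => Subsingleton.elim _ _)

theorem d_comm (h : IsColorDiffSimple 𝒜 ε D d δd) (i j : I) :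
    d i * d j = ε (δd i) (δd j) • (d j * d i) :=
  F1D_colorComm h.bichar h.comm h.graded h.colorComm (h.mem i).1 (h.mem j).1 (h.der i).1 (h.der j).1

theorem D_comm (h : IsColorDiffSimple 𝒜 ε D d δd) {δ : Γ} {f : Module.End F A} (hf : f ∈ D)
    (hfδ : IsColorDer 𝒜 ε δ f) (j : I) : f * d j = ε δ (δd j) • (d j * f) :=
  F1D_colorComm h.bichar h.comm h.graded h.colorComm (Algebra.subset_adjoin (.inr hf)) (h.mem j).1
    hfδ.1 (h.der j).1

theorem d_map_F1 (h : IsColorDiffSimple 𝒜 ε D d δd) {lam : Γ} {u : A} (hu : u ∈ F1 D)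
    (hul : u ∈ 𝒜 lam) (j : I) : d j u = 0 := by
  have := F1D_colorComm h.bichar h.comm h.graded h.colorComm (h.mem j).1
    (Algebra.subset_adjoin (.inl ⟨u, hu, rfl⟩)) (h.der j).1 (isHomogMap_mulL hul)
  simpa [mulL_apply, (h.der j).map_one h.bichar] using LinearMap.congr_fun this 1

theorem one_mem_F1 (h : IsColorDiffSimple 𝒜 ε D d δd) : (1 : A) ∈ F1 D :=
  map_eq_zero_of_homogeneous h.graded fun _ _ _ hf => hf.map_one h.bichar

theorem gradientSpan_apply_mem (h : IsColorDiffSimple 𝒜 ε D d δd) {lam : Γ} {v : I → A}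
    (hv : v ∈ gradientSpan 𝒜 d lam) (j : I) : v j ∈ 𝒜 (lam + δd j) := by
  induction hv using Submodule.span_induction with
  | mem v hv =>
    obtain ⟨mu, nu, a, b, rfl, ha, hb, rfl⟩ := hv
    have := SetLike.mul_mem_graded ((h.der j).1 _ _ ha) hb
    rwa [add_right_comm] at this
  | zero => exact zero_mem _
  | add v w _ _ hv hw => exact add_mem hv hw
  | smul c v _ hv => exact Submodule.smul_mem _ c hv

theorem gradientSpan_mul_mem {lam nu : Γ} {v : I → A} (hv : v ∈ gradientSpan 𝒜 d lam) {b : A}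
    (hb : b ∈ 𝒜 nu) : (fun j => v j * b) ∈ gradientSpan 𝒜 d (lam + nu) := by
  induction hv using Submodule.span_induction with
  | mem v hv =>
    obtain ⟨mu, nu', a, b', rfl, ha, hb', rfl⟩ := hv
    refine Submodule.subset_span ⟨mu, nu' + nu, a, b' * b, (add_assoc _ _ _).symm, ha,
      SetLike.mul_mem_graded hb' hb, ?_⟩
    simp only [mul_assoc]
  | zero => simp only [Pi.zero_apply, zero_mul]; exact zero_mem _
  | add v w _ _ hv hw =>
    convert add_mem hv hw using 1
    ext j
    simp [add_mul]
  | smul c v _ hv =>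
    convert Submodule.smul_mem _ c hv using 1
    ext j
    simp

theorem gradientSpan_map_mem (h : IsColorDiffSimple 𝒜 ε D d δd) {lam δ : Γ} {v : I → A}
    (hv : v ∈ gradientSpan 𝒜 d lam) {f : Module.End F A} (hf : f ∈ D)
    (hfδ : IsColorDer 𝒜 ε δ f) :
    (fun j => ε (δd j) δ • f (v j)) ∈ gradientSpan 𝒜 d (lam + δ) := by
  induction hv using Submodule.span_induction with
  | mem v hv =>
    obtain ⟨mu, nu, a, b, rfl, ha, hb, rfl⟩ := hv
    have key : (fun j => ε (δd j) δ • f (d j a * b)) =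
        (fun j => d j (f a) * b) + ε δ mu • (fun j => d j a * f b) := by
      ext j
      have hc : f (d j a) = ε δ (δd j) • d j (f a) := LinearMap.congr_fun (h.D_comm hf hfδ j) a
      have hs := h.bichar.1 (δd j) δ
      rw [hfδ.2 _ _ ((h.der j).1 _ _ ha), hc, smul_add, smul_mul_assoc, smul_smul, hs, one_smul,
        smul_smul, h.bichar.add_right, mul_left_comm, hs, mul_one]
      rfl
    rw [key]
    refine add_mem (Submodule.subset_span ⟨mu + δ, nu, f a, b, ?_, hfδ.1 _ _ ha, hb, rfl⟩)
      (Submodule.smul_mem _ _ (Submodule.subset_span ⟨mu, nu + δ, a, f b, ?_, ha, hfδ.1 _ _ hb,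
        rfl⟩))
    · abel
    · abel
  | zero => simp only [Pi.zero_apply, map_zero, smul_zero]; exact zero_mem _
  | add v w _ _ hv hw =>
    convert add_mem hv hw using 1
    ext j
    simp
  | smul c v _ hv =>
    convert Submodule.smul_mem _ c hv using 1
    ext j
    simpa using smul_comm _ _ _

/-- The ideal of `i`-th coordinates of vectors in the gradient module vanishing on `T`. -/
def coordIdeal (h : IsColorDiffSimple 𝒜 ε D d δd) (T : Finset I) (i : I) : Ideal A where
  carrier := {x | ∀ mu, ∃ v ∈ gradientSpan 𝒜 d (mu - δd i), (∀ t ∈ T, v t = 0) ∧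
    v i = DirectSum.decompose 𝒜 x mu}
  add_mem' {x y} hx hy mu := by
    obtain ⟨v, hv, hvT, hvi⟩ := hx mu
    obtain ⟨w, hw, hwT, hwi⟩ := hy mu
    refine ⟨v + w, add_mem hv hw, fun t ht => ?_, ?_⟩
    · simp [hvT t ht, hwT t ht]
    · simp [hvi, hwi]
  zero_mem' mu := ⟨0, zero_mem _, by simp, by simp⟩
  smul_mem' b x hx := by
    induction b using DirectSum.Decomposition.inductionOn 𝒜 with
    | zero => exact fun mu => ⟨0, zero_mem _, by simp, by simp⟩
    | @homogeneous lam b =>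
      intro mu
      obtain ⟨v, hv, hvT, hvi⟩ := hx (mu - lam)
      have h1 := gradientSpan_mul_mem hv b.2
      rw [show mu - lam - δd i + lam = mu - δd i by abel] at h1
      refine ⟨_, Submodule.smul_mem _ (ε lam (mu - lam)) h1, fun t ht => ?_, ?_⟩
      · simp [hvT t ht]
      · have h2 := DirectSum.coe_decompose_mul_add_of_left_mem 𝒜 (b := x) (j := mu - lam) b.2
        rw [add_sub_cancel] at h2
        rw [smul_eq_mul, h2, h.comm _ _ _ b.2 _ (SetLike.coe_mem _), ← hvi]
        rfl
    | add b c hb hc =>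
      intro mu
      obtain ⟨v, hv, hvT, hvi⟩ := hb mu
      obtain ⟨w, hw, hwT, hwi⟩ := hc mu
      refine ⟨v + w, add_mem hv hw, fun t ht => ?_, ?_⟩
      · simp [hvT t ht, hwT t ht]
      · simp [add_mul, hvi, hwi]

theorem coordIdeal_isHomogeneous (h : IsColorDiffSimple 𝒜 ε D d δd) (T : Finset I) (i : I) :
    Ideal.IsHomogeneous 𝒜 (h.coordIdeal T i) := by
  intro nu x hx mu
  by_cases hmu : nu = mu
  · subst hmu
    obtain ⟨v, hv, hvT, hvi⟩ := hx nu
    exact ⟨v, hv, hvT, by rw [hvi, DirectSum.decompose_of_mem_same 𝒜 (SetLike.coe_mem _)]⟩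
  · exact ⟨0, zero_mem _, by simp, by
      rw [DirectSum.decompose_of_mem_ne 𝒜 (SetLike.coe_mem _) hmu]; rfl⟩

theorem coordIdeal_stable (h : IsColorDiffSimple 𝒜 ε D d δd) (T : Finset I) (i : I)
    {f : Module.End F A} (hf : f ∈ D) {x : A} (hx : x ∈ h.coordIdeal T i) :
    f x ∈ h.coordIdeal T i := by
  rw [h.graded] at hf
  induction hf using Submodule.span_induction with
  | mem f hf =>
    obtain ⟨hf, δ, hδ⟩ := hf
    intro mu
    obtain ⟨v, hv, hvT, hvi⟩ := hx (mu - δ)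
    have h1 := h.gradientSpan_map_mem hv hf hδ
    rw [show mu - δ - δd i + δ = mu - δd i by abel] at h1
    refine ⟨_, Submodule.smul_mem _ (ε δ (δd i)) h1, fun t ht => ?_, ?_⟩
    · simp [hvT t ht]
    · simp [proj_homogeneous hδ.1, hvi, smul_smul, h.bichar.1]
  | zero => exact zero_mem _
  | add f g _ _ hf hg => exact add_mem hf hg
  | smul c f _ hf =>
    have := (h.coordIdeal T i).mul_mem_left (algebraMap F A c) hf
    rwa [← Algebra.smul_def] at this

theorem exists_dual_of_notMem (h : IsColorDiffSimple 𝒜 ε D d δd) (T : Finset I) :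
    ∀ i ∉ T, ∃ v ∈ gradientSpan 𝒜 d (-δd i), v i = 1 ∧ ∀ t ∈ T, v t = 0 := by
  induction T using Finset.strongInduction with
  | H T ih =>
  intro i hi
  obtain hbot | htop := h.simple _ (h.coordIdeal_isHomogeneous T i)
    fun f hf x hx => h.coordIdeal_stable T i hf hx
  swap
  · have h1 : (1 : A) ∈ h.coordIdeal T i := htop ▸ Submodule.mem_top
    obtain ⟨v, hv, hvT, hvi⟩ := h1 0
    rw [zero_sub] at hv
    exact ⟨v, hv, by
      rw [hvi, DirectSum.decompose_of_mem_same 𝒜 (SetLike.one_mem_graded 𝒜)], hvT⟩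
  exfalso
  have hzero : ∀ lam, ∀ v ∈ gradientSpan 𝒜 d lam, (∀ t ∈ T, v t = 0) → v i = 0 := by
    intro lam v hv hvT
    suffices hvi : v i ∈ h.coordIdeal T i by
      rwa [hbot] at hvi
    intro mu
    by_cases hmu : lam + δd i = mu
    · subst hmu
      refine ⟨v, by rwa [add_sub_cancel_right], hvT, ?_⟩
      rw [DirectSum.decompose_of_mem_same 𝒜 (h.gradientSpan_apply_mem hv i)]
    · refine ⟨0, zero_mem _, by simp, ?_⟩
      rw [DirectSum.decompose_of_mem_ne 𝒜 (h.gradientSpan_apply_mem hv i) hmu]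
      rfl
  have hdual : ∀ t ∈ T, ∃ v ∈ gradientSpan 𝒜 d (-δd t), v t = 1 ∧ ∀ s ∈ T.erase t, v s = 0 :=
    fun t ht => ih _ (Finset.erase_ssubset ht) t (Finset.notMem_erase t T)
  choose! e he het hes using hdual
  have hu : ∀ t ∈ T, e t i ∈ F1 D := by
    intro t ht
    refine map_eq_zero_of_homogeneous h.graded fun δ f hf hδ => ?_
    have := hzero _ _ (h.gradientSpan_map_mem (he t ht) hf hδ) fun s hs => by
      by_cases hst : s = t
      · subst hst; simp [het s hs, hδ.map_one h.bichar]
      · simp [hes t ht s (Finset.mem_erase.2 ⟨hst, hs⟩)]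
    exact (smul_eq_zero.1 this).resolve_left (h.bichar.ne_zero _ _)
  have hdi : d i = ∑ t ∈ T, mulL F A (e t i) * d t := by
    refine ext_homogeneous (𝒜 := 𝒜) fun mu a ha => ?_
    have hw : (fun j => d j a) - ∑ t ∈ T, (fun j => e t j * d t a) ∈ gradientSpan 𝒜 d mu := by
      refine sub_mem (Submodule.subset_span ⟨mu, 0, a, 1, add_zero _, ha,
        SetLike.one_mem_graded 𝒜, by simp⟩) (sum_mem fun t ht => ?_)
      have := gradientSpan_mul_mem (he t ht) ((h.der t).1 _ _ ha)
      rwa [show -δd t + (mu + δd t) = mu by abel] at this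
    have := hzero _ _ hw fun s hs => by
      rw [Pi.sub_apply, Finset.sum_apply, Finset.sum_eq_single s, het s hs, one_mul, sub_self]
      · intro t ht hts
        rw [hes t ht s (Finset.mem_erase.2 ⟨hts.symm, hs⟩), zero_mul]
      · exact fun hns => (hns hs).elim
    rw [Pi.sub_apply, Finset.sum_apply, sub_eq_zero] at this
    rw [this, LinearMap.sum_apply]
    rfl
  have := h.nontrivial
  have hrel := h.indep (insert i T) (fun j => if j = i then -1 else if j ∈ T then e j i else 0)
    (fun j => by
      split_ifs with h1 h2
      · exact neg_mem h.one_mem_F1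
      · exact hu j h2
      · exact zero_mem _)
    (by
      have hneg : mulL F A (-1) * d i = -d i := by
        ext a
        simp [mulL_apply]
      rw [Finset.sum_insert hi, if_pos rfl, hneg, neg_add_eq_zero, hdi]
      refine Finset.sum_congr rfl fun t ht => ?_
      rw [if_neg (ne_of_mem_of_not_mem ht hi), if_pos ht]) i (Finset.mem_insert_self i T)
  simp at hrel

theorem exists_dual [Fintype I] (h : IsColorDiffSimple 𝒜 ε D d δd) (i : I) :
    ∃ v ∈ gradientSpan 𝒜 d (-δd i), v i = 1 ∧ ∀ j, j ≠ i → v j = 0 := by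
  obtain ⟨v, hv, hvi, hvT⟩ := h.exists_dual_of_notMem (Finset.univ.erase i) i (by simp)
  exact ⟨v, hv, hvi, fun j hj => hvT j (by simp [hj])⟩

end IsColorDiffSimple

/-- The operator of a word in the `d i`. -/
def wordOp (d : I → Module.End F A) (w : List I) : Module.End F A := (w.map d).prod

/-- The degree of a word in the `d i`. -/
def wordDeg (δd : I → Γ) (w : List I) : Γ := (w.map δd).sum

/-- The sorted word with multiplicities `α`. -/
def sortedWord (α : I →₀ ℕ) : List I :=
  (α.support.sort (· ≤ ·)).flatMap fun i => List.replicate (α i) i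

/-- Differential operators spanned by words of length less than `n`. -/
def wordFiltration (d : I → Module.End F A) (n : ℕ) : Submodule F (Module.End F A) :=
  Submodule.span F {x | ∃ b w, w.length < n ∧ x = mulL F A b * wordOp d w}

/-- Differential operators spanned by the `b d^α` with `α ∈ 𝒥` of size less than `n`. -/
def reducedFiltration (ε : Γ → Γ → F) (d : I → Module.End F A) (δd : I → Γ) (n : ℕ) :
    Submodule F (Module.End F A) :=
  Submodule.span F {x | ∃ b α, inJ ε δd α ∧ (Finsupp.toMultiset α).card < n ∧
    x = mulL F A b * dpow d α}

theorem wordOp_cons (d : I → Module.End F A) (i : I) (w : List I) :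
    wordOp d (i :: w) = d i * wordOp d w := by
  simp [wordOp]

theorem wordOp_append (d : I → Module.End F A) (w w' : List I) :
    wordOp d (w ++ w') = wordOp d w * wordOp d w' := by
  simp [wordOp]

theorem wordDeg_cons (δd : I → Γ) (i : I) (w : List I) :
    wordDeg δd (i :: w) = δd i + wordDeg δd w := by
  simp [wordDeg]

theorem coe_sortedWord (α : I →₀ ℕ) : (sortedWord α : Multiset I) = Finsupp.toMultiset α := by
  ext j
  rw [Finsupp.count_toMultiset, Multiset.coe_count, sortedWord, List.count_flatMap,
    ← List.sum_toFinset _ (Finset.sort_nodup _ _), Finset.sort_toFinset]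
  simp only [Function.comp_apply, List.count_replicate, beq_iff_eq, Finset.sum_ite_eq']
  simpa using fun h => h.symm

theorem dpow_eq_wordOp (d : I → Module.End F A) (α : I →₀ ℕ) :
    dpow d α = wordOp d (sortedWord α) := by
  rw [dpow, wordOp, sortedWord]
  induction α.support.sort (· ≤ ·) with
  | nil => rfl
  | cons i l ih => simp [ih]

theorem wordFiltration_mono (d : I → Module.End F A) {m n : ℕ} (hmn : m ≤ n) :
    wordFiltration d m ≤ wordFiltration d n := by
  refine Submodule.span_mono ?_
  rintro x ⟨b, w, hw, rfl⟩
  exact ⟨b, w, hw.trans_le hmn, rfl⟩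

theorem reducedFiltration_mono (ε : Γ → Γ → F) (d : I → Module.End F A) (δd : I → Γ) {m n : ℕ}
    (hmn : m ≤ n) : reducedFiltration ε d δd m ≤ reducedFiltration ε d δd n := by
  refine Submodule.span_mono ?_
  rintro x ⟨b, α, hα, hlt, rfl⟩
  exact ⟨b, α, hα, hlt.trans_le hmn, rfl⟩

theorem mulL_mul_mem_wordFiltration {d : I → Module.End F A} {n : ℕ} {x : Module.End F A}
    (hx : x ∈ wordFiltration d n) (c : A) : mulL F A c * x ∈ wordFiltration d n := by
  induction hx using Submodule.span_induction with
  | mem x hx =>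
    obtain ⟨b, w, hw, rfl⟩ := hx
    exact Submodule.subset_span ⟨c * b, w, hw, by rw [mulL_mul, mul_assoc]⟩
  | zero => rw [mul_zero]; exact zero_mem _
  | add x y _ _ hx hy => rw [mul_add]; exact add_mem hx hy
  | smul r x _ hx => rw [mul_smul_comm]; exact Submodule.smul_mem _ _ hx

theorem mulL_mul_wordOp_mem {d : I → Module.End F A} {n : ℕ} (b : A) {w : List I}
    (hw : w.length < n) : mulL F A b * wordOp d w ∈ wordFiltration d n :=
  Submodule.subset_span ⟨b, w, hw, rfl⟩

namespace IsColorDiffSimple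

variable {𝒜 : Γ → Submodule F A} [GradedAlgebra 𝒜] {ε : Γ → Γ → F}
  {D : Submodule F (Module.End F A)} {d : I → Module.End F A} {δd : I → Γ}

theorem wordOp_mem_F1D (h : IsColorDiffSimple 𝒜 ε D d δd) (w : List I) : wordOp d w ∈ F1D D :=
  Subalgebra.list_prod_mem _ fun x hx => by
    obtain ⟨i, -, rfl⟩ := List.mem_map.1 hx
    exact (h.mem i).1

theorem isHomogMap_wordOp (h : IsColorDiffSimple 𝒜 ε D d δd) (w : List I) :
    IsHomogMap 𝒜 (wordDeg δd w) (wordOp d w) := by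
  induction w with
  | nil => exact isHomogMap_one
  | cons i w ih => rw [wordOp_cons, wordDeg_cons]; exact (h.der i).1.mul ih

theorem d_mul_wordOp (h : IsColorDiffSimple 𝒜 ε D d δd) (i : I) (w : List I) :
    d i * wordOp d w = ε (δd i) (wordDeg δd w) • (wordOp d w * d i) :=
  F1D_colorComm h.bichar h.comm h.graded h.colorComm (h.mem i).1 (h.wordOp_mem_F1D w) (h.der i).1
    (h.isHomogMap_wordOp w)

theorem wordOp_perm (h : IsColorDiffSimple 𝒜 ε D d δd) {w w' : List I} (hw : w.Perm w') :
    ∃ c : F, c ≠ 0 ∧ wordOp d w = c • wordOp d w' := by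
  induction hw with
  | nil => exact ⟨1, one_ne_zero, (one_smul _ _).symm⟩
  | cons i _ ih =>
    obtain ⟨c, hc, hcw⟩ := ih
    exact ⟨c, hc, by rw [wordOp_cons, hcw, mul_smul_comm, wordOp_cons]⟩
  | swap i j w =>
    refine ⟨ε (δd j) (δd i), h.bichar.ne_zero _ _, ?_⟩
    rw [wordOp_cons, wordOp_cons, ← mul_assoc, h.d_comm, smul_mul_assoc, mul_assoc, ← wordOp_cons,
      ← wordOp_cons]
  | trans _ _ ih₁ ih₂ =>
    obtain ⟨c, hc, hcw⟩ := ih₁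
    obtain ⟨c', hc', hcw'⟩ := ih₂
    exact ⟨c * c', mul_ne_zero hc hc', by rw [hcw, hcw', smul_smul]⟩

theorem d_mul_mem_wordFiltration (h : IsColorDiffSimple 𝒜 ε D d δd) (i : I) {n : ℕ}
    {x : Module.End F A} (hx : x ∈ wordFiltration d n) : d i * x ∈ wordFiltration d (n + 1) := by
  induction hx using Submodule.span_induction with
  | mem x hx =>
    obtain ⟨b, w, hw, rfl⟩ := hx
    refine mem_of_homogeneous (𝒜 := 𝒜) (f := LinearMap.mulLeft F (d i) ∘ₗ
      LinearMap.mulRight F (wordOp d w) ∘ₗ mulL F A) (fun lam a ha => ?_) b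
    change d i * (mulL F A a * wordOp d w) ∈ _
    rw [← mul_assoc, (h.der i).mul_mulL ha, add_mul, smul_mul_assoc, mul_assoc, ← wordOp_cons]
    exact add_mem (mulL_mul_wordOp_mem _ (by omega))
      (Submodule.smul_mem _ _ (mulL_mul_wordOp_mem _ (by simpa using hw)))
  | zero => rw [mul_zero]; exact zero_mem _
  | add x y _ _ hx hy => rw [mul_add]; exact add_mem hx hy
  | smul r x _ hx => rw [mul_smul_comm]; exact Submodule.smul_mem _ _ hx

theorem wordOp_mulL_sub_mem (h : IsColorDiffSimple 𝒜 ε D d δd) {lam : Γ} {a : A}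
    (ha : a ∈ 𝒜 lam) (w : List I) :
    wordOp d w * mulL F A a - ε (wordDeg δd w) lam • (mulL F A a * wordOp d w) ∈
      wordFiltration d w.length := by
  induction w with
  | nil =>
    simp [wordOp, wordDeg, h.bichar.zero_left]
  | cons j w ih =>
    rw [List.length_cons]
    have h1 := h.d_mul_mem_wordFiltration j ih
    have h2 : ε (wordDeg δd w) lam • (mulL F A (d j a) * wordOp d w) ∈
        wordFiltration d (w.length + 1) :=
      Submodule.smul_mem _ _ (mulL_mul_wordOp_mem _ (Nat.lt_succ_self _))
    convert add_mem h1 h2 using 1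
    have h3 : d j * (mulL F A a * wordOp d w) = mulL F A (d j a) * wordOp d w +
        ε (δd j) lam • (mulL F A a * (d j * wordOp d w)) := by
      rw [← mul_assoc, (h.der j).mul_mulL ha, add_mul, smul_mul_assoc, mul_assoc]
    rw [wordOp_cons, wordDeg_cons, h.bichar.add_left, mul_sub, mul_smul_comm, h3, mul_assoc]
    module

theorem F1D_le_AD : F1D D ≤ AD D :=
  Algebra.adjoin_mono (Set.union_subset_union_left _ (Set.image_subset_range _ _))

theorem mulL_mem_AD (a : A) : mulL F A a ∈ AD D := Algebra.subset_adjoin (.inl ⟨a, rfl⟩)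

theorem wordOp_mem_AD (h : IsColorDiffSimple 𝒜 ε D d δd) (w : List I) : wordOp d w ∈ AD D :=
  F1D_le_AD (h.wordOp_mem_F1D w)

/-- Multiplying commutators of a word with elements of `A` on both sides stays in `W`. -/
theorem mulL_mul_bracket_mul_mem (h : IsColorDiffSimple 𝒜 ε D d δd) {mu nu : Γ} {a b : A}
    (ha : a ∈ 𝒜 mu) (hb : b ∈ 𝒜 nu) (w : List I) (c : A) :
    mulL F A c * ((wordOp d w * mulL F A a - ε (wordDeg δd w) mu • (mulL F A a * wordOp d w)) *
      mulL F A b) ∈ Wsub 𝒜 ε D := by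
  set x := (wordOp d w * mulL F A a - ε (wordDeg δd w) mu • (mulL F A a * wordOp d w)) *
    mulL F A b with hx
  refine mem_of_homogeneous (𝒜 := 𝒜) (f := LinearMap.mulRight F x ∘ₗ mulL F A)
    (fun lam c hc => ?_) c
  change mulL F A c * x ∈ _
  have hmem : mulL F A c * wordOp d w * mulL F A b ∈ AD D :=
    mul_mem (mul_mem (mulL_mem_AD c) (h.wordOp_mem_AD w)) (mulL_mem_AD b)
  have hhom := ((isHomogMap_mulL hc).mul (h.isHomogMap_wordOp w)).mul (isHomogMap_mulL hb)
  have hW : _ ∈ Wsub 𝒜 ε D := Submodule.subset_span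
    ⟨_, _, _, _, hmem, mulL_mem_AD a, hhom, isHomogMap_mulL ha, rfl⟩
  have key := Submodule.smul_mem _ (ε mu nu) hW
  convert key using 1
  have hba : mulL F A b * mulL F A a = ε nu mu • (mulL F A a * mulL F A b) := by
    rw [← mulL_mul, h.comm _ _ _ hb _ ha, map_smul, mulL_mul]
  have hac : mulL F A a * mulL F A c = ε mu lam • (mulL F A c * mulL F A a) := by
    rw [← mulL_mul, h.comm _ _ _ ha _ hc, map_smul, mulL_mul]
  have e1 : mulL F A c * wordOp d w * mulL F A b * mulL F A a =
      ε nu mu • (mulL F A c * wordOp d w * mulL F A a * mulL F A b) := by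
    rw [mul_assoc (_ * _), hba, mul_smul_comm, ← mul_assoc]
  have e2 : mulL F A a * (mulL F A c * wordOp d w * mulL F A b) =
      ε mu lam • (mulL F A c * mulL F A a * wordOp d w * mulL F A b) := by
    rw [← mul_assoc, ← mul_assoc, hac, smul_mul_assoc, smul_mul_assoc]
  rw [e1, e2, hx, sub_mul, mul_sub, smul_mul_assoc, mul_smul_comm, ← mul_assoc, ← mul_assoc,
    ← mul_assoc, ← mul_assoc, smul_sub, smul_smul, smul_smul, smul_smul, h.bichar.1, one_smul]
  congr 2
  rw [h.bichar.add_left, h.bichar.add_left]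
  linear_combination (-(ε (wordDeg δd w) mu) * (ε mu nu * ε nu mu)) * h.bichar.1 mu lam
    - ε (wordDeg δd w) mu * h.bichar.1 mu nu

/-- Every vector of the gradient module induces a contraction of words with values in `W`, which is
a derivation up to terms of lower order. -/
theorem exists_contraction (h : IsColorDiffSimple 𝒜 ε D d δd) {lam : Γ} {v : I → A}
    (hv : v ∈ gradientSpan 𝒜 d lam) :
    ∃ Φ : List I → Module.End F A, (∀ w c, mulL F A c * Φ w ∈ Wsub 𝒜 ε D) ∧ Φ [] = 0 ∧
      ∀ j w, Φ (j :: w) - (d j * Φ w + ε (wordDeg δd w) lam • (mulL F A (v j) * wordOp d w)) ∈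
        wordFiltration d w.length := by
  induction hv using Submodule.span_induction with
  | mem v hv =>
    obtain ⟨mu, nu, a, b, rfl, ha, hb, rfl⟩ := hv
    refine ⟨fun w => (wordOp d w * mulL F A a - ε (wordDeg δd w) mu • (mulL F A a * wordOp d w)) *
      mulL F A b, fun w c => h.mulL_mul_bracket_mul_mem ha hb w c, ?_, fun j w => ?_⟩
    · simp [wordOp, wordDeg, h.bichar.zero_left]
    · have h1 := Submodule.smul_mem _ (ε (wordDeg δd w) mu)
        (mulL_mul_mem_wordFiltration (h.wordOp_mulL_sub_mem hb w) (d j a))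
      convert h1 using 1
      have h3 : d j * (mulL F A a * wordOp d w) = mulL F A (d j a) * wordOp d w +
          ε (δd j) mu • (mulL F A a * (d j * wordOp d w)) := by
        rw [← mul_assoc, (h.der j).mul_mulL ha, add_mul, smul_mul_assoc, mul_assoc]
      beta_reduce
      rw [wordOp_cons, wordDeg_cons, h.bichar.add_left, h.bichar.add_right, ← mul_assoc (d j),
        mul_sub (d j), mul_smul_comm, h3, mulL_mul]
      simp only [sub_mul, add_mul, smul_mul_assoc, mul_assoc, mul_sub, mul_smul_comm]
      module
  | zero =>
    exact ⟨0, by simp, rfl, by simp⟩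
  | add v v' _ _ hv hv' =>
    obtain ⟨Φ, h1, h2, h3⟩ := hv
    obtain ⟨Φ', h1', h2', h3'⟩ := hv'
    refine ⟨Φ + Φ', fun w c => ?_, by simp [h2, h2'], fun j w => ?_⟩
    · rw [Pi.add_apply, mul_add]; exact add_mem (h1 w c) (h1' w c)
    · convert add_mem (h3 j w) (h3' j w) using 1
      simp only [Pi.add_apply, mul_add, map_add, add_mul]
      module
  | smul c v _ hv =>
    obtain ⟨Φ, h1, h2, h3⟩ := hv
    refine ⟨c • Φ, fun w b => ?_, by simp [h2], fun j w => ?_⟩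
    · rw [Pi.smul_apply, mul_smul_comm]; exact Submodule.smul_mem _ _ (h1 w b)
    · convert Submodule.smul_mem _ c (h3 j w) using 1
      simp only [Pi.smul_apply, mul_smul_comm, map_smul, smul_mul_assoc]
      module

theorem exists_wordOp_sub_mem [Fintype I] (h : IsColorDiffSimple 𝒜 ε D d δd) (i : I) {y : List I}
    (hy : i ∉ y) (m : ℕ) (hm : m = 0 ∨ ε (δd i) (δd i) = 1) :
    ∃ x : Module.End F A, (∀ c, mulL F A c * x ∈ Wsub 𝒜 ε D) ∧ ∃ r : F, r ≠ 0 ∧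
      x - ((m + 1 : ℕ) * r) • wordOp d (List.replicate m i ++ y) ∈
        wordFiltration d (m + y.length) := by
  obtain ⟨v, hv, hvi, hvj⟩ := h.exists_dual i
  obtain ⟨Φ, hΦ, hnil, hcons⟩ := h.exists_contraction hv
  have hlow : ∀ z : List I, i ∉ z → ∀ j, d j * Φ z ∈ wordFiltration d z.length := by
    intro z
    induction z with
    | nil => intro _ j; rw [hnil, mul_zero]; exact zero_mem _
    | cons k z ih =>
      intro hz j
      rw [List.mem_cons, not_or] at hz
      refine h.d_mul_mem_wordFiltration j ?_
      have h1 := hcons k z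
      rw [hvj k (Ne.symm hz.1), map_zero, zero_mul, smul_zero, add_zero] at h1
      have := add_mem h1 (ih hz.2 k)
      rwa [sub_add_cancel] at this
  refine ⟨Φ (i :: (List.replicate m i ++ y)), fun c => hΦ _ c, ε (wordDeg δd y) (-δd i),
    h.bichar.ne_zero _ _, ?_⟩
  induction m with
  | zero =>
    have h1 := add_mem (hcons i y) (hlow y hy i)
    rw [hvi, mulL_one, one_mul] at h1
    rw [Nat.zero_add]
    convert h1 using 1
    simp only [List.replicate_zero, List.nil_append, Nat.zero_add, Nat.cast_one]
    module
  | succ m ih =>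
    have hi : ε (δd i) (δd i) = 1 := hm.resolve_left m.succ_ne_zero
    have h1 := h.d_mul_mem_wordFiltration i (ih (.inr hi))
    have h2 := hcons i (List.replicate (m + 1) i ++ y)
    rw [hvi, mulL_one, one_mul] at h2
    have hdeg : ∀ n, ε (wordDeg δd (List.replicate n i ++ y)) (-δd i) =
        ε (wordDeg δd y) (-δd i) := by
      intro n
      induction n with
      | zero => rfl
      | succ n ih =>
        rw [List.replicate_succ, List.cons_append, wordDeg_cons, h.bichar.add_left, ih,
          h.bichar.neg_right, hi, one_mul]
    rw [hdeg] at h2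
    have hlen : (List.replicate (m + 1) i ++ y).length = m + y.length + 1 := by
      simp; omega
    rw [hlen] at h2
    rw [show m + 1 + y.length = m + y.length + 1 by omega]
    convert add_mem h1 h2 using 1
    rw [mul_sub, mul_smul_comm, ← wordOp_cons, List.replicate_succ, List.cons_append]
    push_cast
    module

theorem exists_perm_replicate_append {i : I} {m : ℕ} {w : List I} (hm : m ≤ w.count i) :
    ∃ y : List I, w.Perm (List.replicate m i ++ y) :=
  (List.replicate_sublist_iff.2 hm).exists_perm_append

theorem wordOp_replicate (d : I → Module.End F A) (i : I) (m : ℕ) :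
    wordOp d (List.replicate m i) = d i ^ m := by
  simp [wordOp]

theorem mulL_mul_wordOp_mem_reduced (h : IsColorDiffSimple 𝒜 ε D d δd) (w : List I) (b : A) :
    mulL F A b * wordOp d w ∈ reducedFiltration ε d δd (w.length + 1) := by
  induction hn : w.length using Nat.strong_induction_on generalizing w b with
  | _ n ih =>
  subst hn
  have hodd : ∀ i, ε (δd i) (δd i) = -1 → 2 ≤ w.count i →
      mulL F A b * wordOp d w ∈ reducedFiltration ε d δd (w.length + 1) := by
    intro i hi hcount
    obtain ⟨y, hy⟩ := exists_perm_replicate_append hcount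
    obtain ⟨c, -, hc⟩ := h.wordOp_perm hy
    have hsq : d i ^ 2 = 0 := by
      have h1 := h.d_comm i i
      rw [hi] at h1
      have h2 : (2 : F) • (d i * d i) = d i * d i - (-1 : F) • (d i * d i) := by module
      rw [← h1, sub_self] at h2
      rw [pow_two]
      exact (smul_eq_zero.1 h2).resolve_left h.two_ne_zero
    rw [hc, wordOp_append, wordOp_replicate, hsq, zero_mul, smul_zero, mul_zero]
    exact zero_mem _
  set κ := Multiset.toFinsupp (w : Multiset I) with hκ
  have hκi : ∀ i, κ i = w.count i := fun i => by simp [hκ]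
  by_cases hJ : inJ ε δd κ
  · have hcoe : (sortedWord κ : Multiset I) = w := by
      rw [coe_sortedWord, hκ, Multiset.toFinsupp_toMultiset]
    obtain ⟨c, -, hc⟩ := h.wordOp_perm (Multiset.coe_eq_coe.1 hcoe.symm)
    rw [hc, ← dpow_eq_wordOp, mul_smul_comm]
    refine Submodule.smul_mem _ _ (Submodule.subset_span ⟨b, κ, hJ, ?_, rfl⟩)
    rw [hκ, Multiset.toFinsupp_toMultiset, Multiset.coe_card]
    exact Nat.lt_succ_self _
  rw [inJ, not_and_or] at hJ
  push Not at hJ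
  obtain ⟨i, hp, hlt⟩ | ⟨i, hi, hlt⟩ := hJ
  swap
  · exact hodd i hi (by rw [← hκi]; omega)
  have hprime : (ringChar F).Prime := CharP.char_prime_of_ne_zero F hp
  have := hprime.two_le
  rw [hκi] at hlt
  obtain hi | hi := h.bichar.self_eq (δd i)
  swap
  · exact hodd i hi (by omega)
  obtain ⟨y, hy⟩ := exists_perm_replicate_append (i := i) (m := ringChar F) (w := w) (by omega)
  obtain ⟨c, -, hc⟩ := h.wordOp_perm hy
  have : Fact (ringChar F).Prime := ⟨hprime⟩
  have hlen := hy.length_eq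
  rw [List.length_append, List.length_replicate] at hlen
  obtain ⟨s, u, -, hsu⟩ := h.exists_sum (d i ^ ringChar F)
    ⟨pow_mem (h.mem i).1 _, Submodule.subset_span ⟨_, (h.der i).pow_char h.bichar hi (ringChar F)⟩⟩
  rw [hc, wordOp_append, wordOp_replicate, hsu, mul_smul_comm, Finset.sum_mul, Finset.mul_sum]
  refine Submodule.smul_mem _ _ (sum_mem fun j _ => ?_)
  rw [mul_assoc, ← wordOp_cons, ← mul_assoc, ← mulL_mul]
  refine reducedFiltration_mono _ _ _ ?_ (ih (j :: y).length ?_ (j :: y) (b * u j) rfl)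
  · simp; omega
  · simp; omega

theorem wordFiltration_le_reduced (h : IsColorDiffSimple 𝒜 ε D d δd) (n : ℕ) :
    wordFiltration d n ≤ reducedFiltration ε d δd n := by
  refine Submodule.span_le.2 ?_
  rintro x ⟨b, w, hw, rfl⟩
  exact reducedFiltration_mono _ _ _ hw (h.mulL_mul_wordOp_mem_reduced w b)

end IsColorDiffSimple

/-- The sum of all `A d^α` with `α ≠ γ` and of `𝒟(A) d^γ`. -/
def derivedTarget (𝒜 : Γ → Submodule F A) (ε : Γ → Γ → F) (D : Submodule F (Module.End F A))
    (d : I → Module.End F A) (δd : I → Γ) (gm : I →₀ ℕ) : Submodule F (Module.End F A) :=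
  Submodule.span F
    ({w : Module.End F A | ∃ α : I →₀ ℕ, inJ ε δd α ∧ α ≠ gm ∧
        ∃ b : A, w = mulL F A b * dpow d α} ∪
     {w : Module.End F A | ∃ c ∈ Submodule.span F {x : A | ∃ f ∈ DScr 𝒜 ε D, ∃ b : A, x = f b},
        w = mulL F A c * dpow d gm})

namespace IsColorDiffSimple

variable {𝒜 : Γ → Submodule F A} [GradedAlgebra 𝒜] {ε : Γ → Γ → F}
  {D : Submodule F (Module.End F A)} {d : I → Module.End F A} {δd : I → Γ}

/-- The degree `δ` part of `A[D]`. -/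
def reducedPart (𝒜 : Γ → Submodule F A) (ε : Γ → Γ → F) (d : I → Module.End F A) (δd : I → Γ)
    (δ : Γ) : Submodule F (Module.End F A) :=
  Submodule.span F {x | ∃ lam b α, b ∈ 𝒜 lam ∧ inJ ε δd α ∧ lam + wordDeg δd (sortedWord α) = δ ∧
    x = mulL F A b * dpow d α}

theorem isHomogMap_dpow (h : IsColorDiffSimple 𝒜 ε D d δd) (α : I →₀ ℕ) :
    IsHomogMap 𝒜 (wordDeg δd (sortedWord α)) (dpow d α) := by
  rw [dpow_eq_wordOp]
  exact h.isHomogMap_wordOp _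

theorem reducedFiltration_le_iSup (n : ℕ) :
    reducedFiltration ε d δd n ≤ ⨆ δ, reducedPart 𝒜 ε d δd δ := by
  refine Submodule.span_le.2 ?_
  rintro x ⟨b, α, hα, -, rfl⟩
  refine mem_of_homogeneous (𝒜 := 𝒜) (f := LinearMap.mulRight F (dpow d α) ∘ₗ mulL F A)
    (fun lam a ha => ?_) b
  exact Submodule.mem_iSup_of_mem _ (Submodule.subset_span ⟨lam, a, α, ha, hα, rfl, rfl⟩)

theorem exists_mem_wordFiltration_of_mem_AD (h : IsColorDiffSimple 𝒜 ε D d δd)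
    {x : Module.End F A} (hx : x ∈ AD D) :
    ∀ n, ∀ y ∈ wordFiltration d n, ∃ m, x * y ∈ wordFiltration d m := by
  induction hx using Algebra.adjoin_induction with
  | mem x hx =>
    intro n y hy
    obtain ⟨a, rfl⟩ | hx := hx
    · exact ⟨n, mulL_mul_mem_wordFiltration hy a⟩
    · obtain ⟨s, c, -, rfl⟩ := h.exists_sum x ⟨Algebra.subset_adjoin (.inr hx), h.le_der hx⟩
      refine ⟨n + 1, ?_⟩
      rw [Finset.sum_mul]
      refine sum_mem fun i _ => ?_
      rw [mul_assoc]
      exact mulL_mul_mem_wordFiltration (h.d_mul_mem_wordFiltration i hy) _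
  | algebraMap r =>
    intro n y hy
    refine ⟨n, ?_⟩
    rw [← Algebra.smul_def]
    exact Submodule.smul_mem _ _ hy
  | add x x' _ _ hx hx' =>
    intro n y hy
    obtain ⟨m, hm⟩ := hx n y hy
    obtain ⟨m', hm'⟩ := hx' n y hy
    refine ⟨max m m', ?_⟩
    rw [add_mul]
    exact add_mem (wordFiltration_mono d (le_max_left _ _) hm)
      (wordFiltration_mono d (le_max_right _ _) hm')
  | mul x x' _ _ hx hx' =>
    intro n y hy
    obtain ⟨m', hm'⟩ := hx' n y hy
    rw [mul_assoc]
    exact hx m' _ hm'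

theorem mem_reducedPart (h : IsColorDiffSimple 𝒜 ε D d δd) {x : Module.End F A} (hx : x ∈ AD D)
    {δ : Γ} (hδ : IsHomogMap 𝒜 δ x) : x ∈ reducedPart 𝒜 ε d δd δ := by
  have hone : (1 : Module.End F A) ∈ wordFiltration d 1 := by
    convert mulL_mul_wordOp_mem (1 : A) (w := ([] : List I)) (n := 1) (by simp)
    simp [wordOp, mulL_one]
  obtain ⟨m, hm⟩ := h.exists_mem_wordFiltration_of_mem_AD hx 1 1 hone
  rw [mul_one] at hm
  refine mem_of_mem_iSup_homogeneous (𝒜 := 𝒜) (fun δ => Submodule.span_le.2 ?_)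
    (reducedFiltration_le_iSup m (h.wordFiltration_le_reduced m hm)) hδ
  rintro x ⟨lam, b, α, hb, -, rfl, rfl⟩
  exact (isHomogMap_mulL hb).mul (h.isHomogMap_dpow α)

theorem card_lt_of_ne {gm α : I →₀ ℕ} (hle : ∀ i, α i ≤ gm i) (hne : α ≠ gm) :
    (Finsupp.toMultiset α).card < (Finsupp.toMultiset gm).card :=
  Multiset.card_strictMono (Finsupp.toMultiset_strictMono (lt_of_le_of_ne hle hne))

theorem reducedFiltration_le_target (gm : I →₀ ℕ) :
    reducedFiltration ε d δd (Finsupp.toMultiset gm).card ≤ derivedTarget 𝒜 ε D d δd gm := by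
  refine Submodule.span_le.2 ?_
  rintro x ⟨b, α, hα, hlt, rfl⟩
  refine Submodule.subset_span (.inl ⟨α, hα, ?_, b, rfl⟩)
  rintro rfl
  exact hlt.false

theorem length_sortedWord (α : I →₀ ℕ) :
    (sortedWord α).length = (Finsupp.toMultiset α).card := by
  rw [← coe_sortedWord, Multiset.coe_card]

theorem bracket_mulL_mem (h : IsColorDiffSimple 𝒜 ε D d δd) {gm : I →₀ ℕ}
    (hmax : ∀ α : I →₀ ℕ, inJ ε δd α → ∀ i, α i ≤ gm i) {lam δ : Γ} {a : A} (ha : a ∈ 𝒜 lam)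
    {y : Module.End F A} (hy : y ∈ reducedPart 𝒜 ε d δd δ) :
    mulL F A a * y - ε lam δ • (y * mulL F A a) ∈ derivedTarget 𝒜 ε D d δd gm := by
  induction hy using Submodule.span_induction with
  | mem y hy =>
    obtain ⟨mu, b, α, hb, hα, rfl, rfl⟩ := hy
    have hle : (Finsupp.toMultiset α).card ≤ (Finsupp.toMultiset gm).card :=
      Multiset.card_le_card (Finsupp.toMultiset_strictMono.monotone (hmax α hα))
    have h1 := mulL_mul_mem_wordFiltration (h.wordOp_mulL_sub_mem ha (sortedWord α)) b
    rw [length_sortedWord, ← dpow_eq_wordOp] at h1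
    have h2 := Submodule.smul_mem _ (-ε lam (mu + wordDeg δd (sortedWord α)))
      (reducedFiltration_le_target (𝒜 := 𝒜) (D := D) gm
        (reducedFiltration_mono _ _ _ hle (h.wordFiltration_le_reduced _ h1)))
    convert h2 using 1
    have hba : mulL F A b * (mulL F A a * dpow d α) =
        ε mu lam • (mulL F A a * (mulL F A b * dpow d α)) := by
      rw [← mul_assoc, ← mulL_mul, h.comm _ _ _ hb _ ha, map_smul, mulL_mul, smul_mul_assoc,
        mul_assoc]
    rw [mul_sub, mul_smul_comm, hba, smul_smul, smul_sub, smul_smul, mul_assoc,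
      h.bichar.add_right]
    have hs : -(ε lam mu * ε lam (wordDeg δd (sortedWord α))) *
        (ε (wordDeg δd (sortedWord α)) lam * ε mu lam) = -1 := by
      linear_combination (-(ε lam mu * ε mu lam)) * h.bichar.1 lam (wordDeg δd (sortedWord α)) -
        h.bichar.1 lam mu
    rw [hs]
    module
  | zero => simp
  | add x y _ _ hx hy =>
    convert add_mem hx hy using 1
    rw [mul_add, add_mul]
    module
  | smul c x _ hx =>
    convert Submodule.smul_mem _ c hx using 1
    rw [mul_smul_comm, smul_mul_assoc]
    module

theorem bracket_d_mul (h : IsColorDiffSimple 𝒜 ε D d δd) (i : I) {mu : Γ} {b : A} (hb : b ∈ 𝒜 mu)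
    (w : List I) : d i * (mulL F A b * wordOp d w) -
      ε (δd i) (mu + wordDeg δd w) • (mulL F A b * wordOp d w * d i) =
        mulL F A (d i b) * wordOp d w := by
  rw [← mul_assoc, (h.der i).mul_mulL hb, add_mul, smul_mul_assoc, mul_assoc, h.d_mul_wordOp,
    h.bichar.add_right, mul_smul_comm, mul_assoc]
  module

theorem bracket_d_mem (h : IsColorDiffSimple 𝒜 ε D d δd) (gm : I →₀ ℕ) {δ : Γ} (i : I)
    {y : Module.End F A} (hy : y ∈ reducedPart 𝒜 ε d δd δ) :
    d i * y - ε (δd i) δ • (y * d i) ∈ derivedTarget 𝒜 ε D d δd gm := by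
  induction hy using Submodule.span_induction with
  | mem y hy =>
    obtain ⟨mu, b, α, hb, hα, rfl, rfl⟩ := hy
    rw [dpow_eq_wordOp, h.bracket_d_mul i hb, ← dpow_eq_wordOp]
    by_cases hgm : α = gm
    · subst hgm
      exact Submodule.subset_span (.inr ⟨_, Submodule.subset_span ⟨d i, h.mem i, b, rfl⟩, rfl⟩)
    · exact Submodule.subset_span (.inl ⟨α, hα, hgm, _, rfl⟩)
  | zero => simp
  | add x y _ _ hx hy =>
    convert add_mem hx hy using 1
    rw [mul_add, add_mul]
    module
  | smul c x _ hx =>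
    convert Submodule.smul_mem _ c hx using 1
    rw [mul_smul_comm, smul_mul_assoc]
    module

/-- If brackets with `x` and `y` lie in a subspace, so do brackets with `x * y`. -/
theorem bracket_mul_mem (h : IsColorDiffSimple 𝒜 ε D d δd) {R : Submodule F (Module.End F A)}
    {lam mu : Γ} {x y : Module.End F A} (hxD : x ∈ AD D) (hyD : y ∈ AD D)
    (hx : IsHomogMap 𝒜 lam x) (hy : IsHomogMap 𝒜 mu y)
    (hxR : ∀ nu z, z ∈ AD D → IsHomogMap 𝒜 nu z → x * z - ε lam nu • (z * x) ∈ R)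
    (hyR : ∀ nu z, z ∈ AD D → IsHomogMap 𝒜 nu z → y * z - ε mu nu • (z * y) ∈ R)
    {nu : Γ} {z : Module.End F A} (hzD : z ∈ AD D) (hz : IsHomogMap 𝒜 nu z) :
    x * y * z - ε (lam + mu) nu • (z * (x * y)) ∈ R := by
  have h1 := hxR _ _ (mul_mem hyD hzD) (hy.mul hz)
  have h2 := Submodule.smul_mem _ (ε lam (mu + nu)) (hyR _ _ (mul_mem hzD hxD) (hz.mul hx))
  convert add_mem h1 h2 using 1
  have hs : ε lam (mu + nu) * ε mu (nu + lam) = ε (lam + mu) nu := by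
    rw [h.bichar.add_right, h.bichar.add_right, h.bichar.add_left]
    linear_combination (ε lam nu * ε mu nu) * h.bichar.1 lam mu
  rw [smul_sub, smul_smul, hs]
  simp only [mul_assoc]
  module

theorem Wsub_le_target (h : IsColorDiffSimple 𝒜 ε D d δd) {gm : I →₀ ℕ}
    (hmax : ∀ α : I →₀ ℕ, inJ ε δd α → ∀ i, α i ≤ gm i) :
    Wsub 𝒜 ε D ≤ derivedTarget 𝒜 ε D d δd gm := by
  refine Submodule.span_le.2 ?_
  rintro _ ⟨lam, nu, x, z, hxD, hzD, hx, hz, rfl⟩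
  have hword : ∀ w : List I, ∀ nu z, z ∈ AD D → IsHomogMap 𝒜 nu z →
      wordOp d w * z - ε (wordDeg δd w) nu • (z * wordOp d w) ∈ derivedTarget 𝒜 ε D d δd gm := by
    intro w
    induction w with
    | nil => intro nu z _ _; simp [wordOp, wordDeg, h.bichar.zero_left]
    | cons i w ih =>
      intro nu z hzD hz
      rw [wordOp_cons, wordDeg_cons]
      exact h.bracket_mul_mem (F1D_le_AD (h.mem i).1) (h.wordOp_mem_AD w) (h.der i).1
        (h.isHomogMap_wordOp w)
        (fun nu z hzD hz => h.bracket_d_mem gm i (h.mem_reducedPart hzD hz)) ih hzD hz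
  have hxr := h.mem_reducedPart hxD hx
  clear hxD hx
  rw [SetLike.mem_coe]
  induction hxr using Submodule.span_induction with
  | mem x hx =>
    obtain ⟨mu, b, α, hb, hα, rfl, rfl⟩ := hx
    rw [dpow_eq_wordOp]
    exact h.bracket_mul_mem (mulL_mem_AD b) (h.wordOp_mem_AD _) (isHomogMap_mulL hb)
      (h.isHomogMap_wordOp _)
      (fun nu z hzD hz => h.bracket_mulL_mem hmax hb (h.mem_reducedPart hzD hz)) (hword _) hzD hz
  | zero => simp
  | add x y _ _ hx hy =>
    convert add_mem hx hy using 1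
    rw [mul_add, add_mul]
    module
  | smul c x _ hx =>
    convert Submodule.smul_mem _ c hx using 1
    rw [mul_smul_comm, smul_mul_assoc]
    module

theorem mulL_mul_dpow_mem_Wsub [Fintype I] (h : IsColorDiffSimple 𝒜 ε D d δd) {gm : I →₀ ℕ}
    (hgm : inJ ε δd gm) (hmax : ∀ α : I →₀ ℕ, inJ ε δd α → ∀ i, α i ≤ gm i) (α : I →₀ ℕ)
    (hα : inJ ε δd α) (hne : α ≠ gm) (b : A) : mulL F A b * dpow d α ∈ Wsub 𝒜 ε D := by
  induction hn : (Finsupp.toMultiset α).card using Nat.strong_induction_on generalizing α b with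
  | _ n ih =>
  subst hn
  have hlow : wordFiltration d (Finsupp.toMultiset α).card ≤ Wsub 𝒜 ε D := by
    refine (h.wordFiltration_le_reduced _).trans (Submodule.span_le.2 ?_)
    rintro x ⟨c, β, hβ, hlt, rfl⟩
    refine ih _ hlt β hβ ?_ c rfl
    rintro rfl
    exact (hlt.trans (card_lt_of_ne (hmax α hα) hne)).false
  obtain ⟨i, hi⟩ : ∃ i, α i < gm i := by
    by_contra! hcon
    exact hne (Finsupp.ext fun i => le_antisymm (hmax α hα i) (hcon i))
  have hcount : (sortedWord α).count i = α i := by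
    rw [← Multiset.coe_count, coe_sortedWord, Finsupp.count_toMultiset]
  obtain ⟨y, hy⟩ := exists_perm_replicate_append hcount.ge
  have hiy : i ∉ y := by
    have := hy.count_eq i
    rw [hcount, List.count_append, List.count_replicate_self] at this
    exact List.count_eq_zero.1 (by omega)
  have hsign : α i = 0 ∨ ε (δd i) (δd i) = 1 := by
    obtain h1 | h1 := h.bichar.self_eq (δd i)
    · exact .inr h1
    · have := hgm.2 i h1
      exact .inl (by omega)
  have hcast : ((α i + 1 : ℕ) : F) ≠ 0 := by
    intro h0
    have hdvd := (ringChar.spec F _).1 h0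
    by_cases hp : ringChar F = 0
    · rw [hp, zero_dvd_iff] at hdvd
      omega
    · have := Nat.le_of_dvd (Nat.succ_pos _) hdvd
      have := hgm.1 i hp
      omega
  obtain ⟨x, hxW, r, hr, hx⟩ := h.exists_wordOp_sub_mem i hiy (α i) hsign
  have hlen : α i + y.length = (Finsupp.toMultiset α).card := by
    have := hy.length_eq
    rw [length_sortedWord, List.length_append, List.length_replicate] at this
    exact this.symm
  rw [hlen] at hx
  have h1 := sub_mem (hxW b) (hlow (mulL_mul_mem_wordFiltration hx b))
  rw [mul_sub, sub_sub_cancel, mul_smul_comm] at h1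
  have h2 := (Submodule.smul_mem_iff _ (mul_ne_zero hcast hr)).1 h1
  obtain ⟨c, -, hc⟩ := h.wordOp_perm hy
  rw [dpow_eq_wordOp, hc, mul_smul_comm]
  exact Submodule.smul_mem _ _ h2

theorem mulL_der_mul_wordOp_mem_Wsub (h : IsColorDiffSimple 𝒜 ε D d δd) (w : List I) {c : A}
    (hc : c ∈ Submodule.span F {x : A | ∃ f ∈ DScr 𝒜 ε D, ∃ b : A, x = f b}) :
    mulL F A c * wordOp d w ∈ Wsub 𝒜 ε D := by
  classical
  induction hc using Submodule.span_induction with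
  | mem x hx =>
    obtain ⟨f, hf, b, rfl⟩ := hx
    obtain ⟨s, u, hu, rfl⟩ := h.exists_sum f hf
    rw [LinearMap.sum_apply, map_sum, Finset.sum_mul]
    refine sum_mem fun i _ => ?_
    change mulL F A (u i * d i b) * wordOp d w ∈ _
    rw [mulL_mul, mul_assoc]
    refine mem_of_homogeneous (𝒜 := 𝒜) (f := LinearMap.mulLeft F (mulL F A (u i)) ∘ₗ
      LinearMap.mulRight F (wordOp d w) ∘ₗ mulL F A ∘ₗ d i) (fun mu a ha => ?_) b
    change mulL F A (u i) * (mulL F A (d i a) * wordOp d w) ∈ _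
    rw [← DirectSum.sum_support_decompose 𝒜 (u i), map_sum, Finset.sum_mul]
    refine sum_mem fun lam _ => ?_
    set v : A := (DirectSum.decompose 𝒜 (u i) lam : A)
    have hvF : v ∈ F1 D := proj_mem_F1 h.graded (hu i) lam
    have hv : v ∈ 𝒜 lam := SetLike.coe_mem _
    have hva : v * a ∈ 𝒜 (lam + mu) := SetLike.mul_mem_graded hv ha
    have hW : d i * (mulL F A (v * a) * wordOp d w) -
        ε (δd i) (lam + mu + wordDeg δd w) • (mulL F A (v * a) * wordOp d w * d i) ∈
          Wsub 𝒜 ε D :=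
      Submodule.subset_span ⟨_, _, _, _, F1D_le_AD (h.mem i).1,
        mul_mem (mulL_mem_AD _) (h.wordOp_mem_AD w), (h.der i).1,
        (isHomogMap_mulL hva).mul (h.isHomogMap_wordOp w), rfl⟩
    rw [h.bracket_d_mul i hva, (h.der i).2 _ _ hv, h.d_map_F1 hvF hv, zero_mul, zero_add,
      map_smul, smul_mul_assoc, Submodule.smul_mem_iff _ (h.bichar.ne_zero _ _), mulL_mul,
      mul_assoc] at hW
    exact hW
  | zero => rw [map_zero, zero_mul]; exact zero_mem _
  | add x y _ _ hx hy => rw [map_add, add_mul]; exact add_mem hx hy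
  | smul r x _ hx => rw [map_smul, smul_mul_assoc]; exact Submodule.smul_mem _ _ hx

theorem finite_of_max {gm : I →₀ ℕ}
    (hmax : ∀ α : I →₀ ℕ, inJ ε δd α → ∀ i, α i ≤ gm i) : Finite I := by
  have hsupp : ∀ i, i ∈ gm.support := by
    intro i
    have hle : ∀ j, Finsupp.single i 1 j ≤ 1 := fun j => by
      rw [Finsupp.single_apply]
      split_ifs <;> simp
    have := hmax (Finsupp.single i 1) ⟨fun j hp => (hle j).trans (by
      have := (CharP.char_prime_of_ne_zero F hp).two_le
      omega), fun j _ => hle j⟩ i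
    rw [Finsupp.single_eq_same] at this
    exact Finsupp.mem_support_iff.2 (by omega)
  exact Finite.of_injective (fun i => (⟨i, hsupp i⟩ : gm.support)) fun i j hij => by simpa using hij

end IsColorDiffSimple

theorem stmt_13
    (𝒜 : Γ → Submodule F A) [GradedAlgebra 𝒜] (ε : Γ → Γ → F)
    (D : Submodule F (Module.End F A))
    (hchar : (2 : F) ≠ 0)
    (hbich : IsBichar ε)
    (hcomm : IsColorComm 𝒜 ε)
    (hDder : D ≤ DerE 𝒜 ε)
    (hDgr : DGraded 𝒜 ε D)
    (hDcc : DColorComm 𝒜 ε D)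
    (hDne : D ≠ ⊥)
    (hsimple : GradedDSimple 𝒜 D)
    (d : I → Module.End F A) (δd : I → Γ)
    (hdD : ∀ i, d i ∈ DScr 𝒜 ε D)
    (hdhom : ∀ i, IsColorDer 𝒜 ε (δd i) (d i))
    (hdspan : ∀ f ∈ DScr 𝒜 ε D, ∃ (s : Finset I) (c : I → A),
      (∀ i, c i ∈ F1 D) ∧ f = ∑ i ∈ s, mulL F A (c i) * d i)
    (hdind : ∀ (s : Finset I) (c : I → A), (∀ i, c i ∈ F1 D) →
      (∑ i ∈ s, mulL F A (c i) * d i) = 0 → ∀ i ∈ s, c i = 0)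
    (hfin : {α : I →₀ ℕ | inJ ε δd α}.Finite)
    (gm : I →₀ ℕ) (hgmJ : inJ ε δd gm)
    (hgmmax : ∀ α : I →₀ ℕ, inJ ε δd α → ∀ i, α i ≤ gm i) :
    Wsub 𝒜 ε D = Submodule.span F
      ({w : Module.End F A | ∃ α : I →₀ ℕ, inJ ε δd α ∧ α ≠ gm ∧
          ∃ b : A, w = mulL F A b * dpow d α} ∪
       {w : Module.End F A | ∃ c ∈ Submodule.span F
            {x : A | ∃ f ∈ DScr 𝒜 ε D, ∃ b : A, x = f b},
          w = mulL F A c * dpow d gm}) := by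
  have h : IsColorDiffSimple 𝒜 ε D d δd :=
    ⟨hchar, hbich, hcomm, hDder, hDgr, hDcc, hDne, hsimple, hdD, hdhom, hdspan, hdind⟩
  have := IsColorDiffSimple.finite_of_max hgmmax
  have := Fintype.ofFinite I
  refine le_antisymm (h.Wsub_le_target hgmmax) (Submodule.span_le.2 ?_)
  rintro w (⟨α, hα, hne, b, rfl⟩ | ⟨c, hc, rfl⟩)
  · exact h.mulL_mul_dpow_mem_Wsub hgmJ hgmmax α hα hne b
  · rw [dpow_eq_wordOp]
    exact h.mulL_der_mul_wordOp_mem_Wsub _ hc
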